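/- arXiv:1205.5613 — 4 statements merged into one kernel-verified Lean document; each statement's English description precedes it below -/
import Mathlib

section
/- Let M be a finite set, K a finite nonempty index set, and T : K → Sym(M) a family of permutations of M such that the set S = { T_k : k ∈ K } is closed under functional composition. Then for every key k ∈ K and all messages x₁, …, x_m ∈ M, the least common multiple of the sizes of the orbits of x₁, …, x_m under the cyclic subgroup ⟨T_k⟩ generated by T_k is at most the cardinality of K. Consequently, if for some key k and messages x₁, …, x_m this least common multiple exceeds |K|, then S is not closed under functional composition and is not a group. -/
theorem MulAction.natCard_orbit_dvd_natCard {G X : Type*} [Group G] [MulAction G X] (x : X) :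
    Nat.card (MulAction.orbit G x) ∣ Nat.card G := by
  rw [Nat.card_coe_set_eq, ← MulAction.index_stabilizer]
  exact Subgroup.index_dvd_card _

theorem pow_succ_mem_of_mul_mem {G : Type*} [Monoid G] {S : Set G}
    (hS : ∀ a ∈ S, ∀ b ∈ S, a * b ∈ S) {g : G} (hg : g ∈ S) (n : ℕ) : g ^ (n + 1) ∈ S := by
  induction n with
  | zero => simpa using hg
  | succ n ih => exact pow_succ g (n + 1) ▸ hS _ ih _ hg

theorem orderOf_le_ncard_of_mul_mem {G : Type*} [Group G] {S : Set G} (hfin : S.Finite)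
    (hS : ∀ a ∈ S, ∀ b ∈ S, a * b ∈ S) {g : G} (hg : g ∈ S) : orderOf g ≤ S.ncard := by
  have hinj : Set.InjOn (fun n => g ^ (n + 1)) (Set.Iio (orderOf g)) := by
    intro a ha b hb hab
    exact pow_injOn_Iio_orderOf ha hb (mul_right_cancel (by simpa only [pow_succ] using hab))
  simpa using Set.ncard_le_ncard_of_injOn _
    (fun n _ => pow_succ_mem_of_mul_mem hS hg n) hinj hfin

/-- Let `M` be a finite set, `K` a finite nonempty index set, and
`T : K → Sym(M)` a family of permutations with `S = {T k : k ∈ K}` closed under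
functional composition. Then for every key `k` and all messages `x₁, …, x_m ∈ M`, the
least common multiple of the sizes of the orbits of the `xᵢ` under the cyclic subgroup
`⟨T k⟩` is at most `|K|`. Consequently, if for some key `k` and messages the least
common multiple exceeds `|K|`, then `S` is not closed under functional composition. -/
theorem lcm_orbit_sizes_le_card_of_closed {M K : Type*} [Finite M] [Finite K]
    [Nonempty K] (T : K → Equiv.Perm M) :
    ((∀ a ∈ Set.range T, ∀ b ∈ Set.range T, a * b ∈ Set.range T) →
      ∀ (k : K) (m : ℕ) (x : Fin m → M),
        Finset.univ.lcm
          (fun i => Nat.card (MulAction.orbit (Subgroup.zpowers (T k)) (x i)))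
          ≤ Nat.card K) ∧
    (∀ (k : K) (m : ℕ) (x : Fin m → M),
      Nat.card K <
        Finset.univ.lcm
          (fun i => Nat.card (MulAction.orbit (Subgroup.zpowers (T k)) (x i))) →
      ¬ (∀ a ∈ Set.range T, ∀ b ∈ Set.range T, a * b ∈ Set.range T)) := by
  have bound (hS : ∀ a ∈ Set.range T, ∀ b ∈ Set.range T, a * b ∈ Set.range T)
      (k : K) (m : ℕ) (x : Fin m → M) :
      Finset.univ.lcm
        (fun i => Nat.card (MulAction.orbit (Subgroup.zpowers (T k)) (x i))) ≤ Nat.card K := by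
    have hdvd : Finset.univ.lcm
        (fun i => Nat.card (MulAction.orbit (Subgroup.zpowers (T k)) (x i))) ∣ orderOf (T k) :=
      Finset.lcm_dvd fun i _ =>
        Nat.card_zpowers (T k) ▸ MulAction.natCard_orbit_dvd_natCard (x i)
    calc _ ≤ orderOf (T k) := Nat.le_of_dvd (orderOf_pos _) hdvd
      _ ≤ (Set.range T).ncard :=
        orderOf_le_ncard_of_mul_mem (Set.finite_range T) hS (Set.mem_range_self k)
      _ ≤ Nat.card K := Finite.card_range_le T
  exact ⟨bound, fun k m x hlt hS => (bound hS k m x).not_gt hlt⟩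
end

section
/- Let A be a finite group and let X be a nonempty set of functions f : A → A that does not contain the constant function with value e. Then the set of 2-round GDES permutations { θ ∘ σ_{f_2} ∘ σ_{f_1} : f₁, f₂ ∈ X } is not a subgroup of the symmetric group on A × A, i.e. it is not the underlying set of any subgroup of Sym(A × A). -/
/-- The Feistel permutation `σ_f` of `A × A` associated to `f : A → A`:
`σ_f (x, y) = (y, x ⊕ f y)`. -/
def feistel {A : Type*} [Group A] (f : A → A) : Equiv.Perm (A × A) where
  toFun p := (p.2, p.1 * f p.2)
  invFun p := (p.2 * (f p.1)⁻¹, p.1)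
  left_inv p := by simp
  right_inv p := by simp

/-- The swap permutation `θ (x, y) = (y, x)` of `A × A`. -/
def swapPerm (A : Type*) : Equiv.Perm (A × A) := Equiv.prodComm A A

/-- Let `A` be a finite group and `X` a nonempty set of functions
`A → A` not containing the constant function with value `e`. Then the set of 2-round
GDES permutations `{θ ∘ σ_{f₂} ∘ σ_{f₁} : f₁, f₂ ∈ X}` is not (the underlying set of)
a subgroup of `Sym(A × A)`. -/
theorem gdes_two_rounds_not_subgroup {A : Type*} [Group A] [Finite A]
    (X : Set (A → A)) (hne : X.Nonempty)
    (hid : (fun _ : A => (1 : A)) ∉ X) :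
    ¬ ∃ H : Subgroup (Equiv.Perm (A × A)),
        (H : Set (Equiv.Perm (A × A))) =
          {g | ∃ f₁ ∈ X, ∃ f₂ ∈ X, g = swapPerm A * feistel f₂ * feistel f₁} := by
  rintro ⟨H, hH⟩
  have h1 : (1 : Equiv.Perm (A × A)) ∈ (H : Set (Equiv.Perm (A × A))) := H.one_mem
  rw [hH] at h1
  obtain ⟨f₁, -, f₂, -, h⟩ := h1
  have hsnd (x y : A) : y = x * f₁ y := congrArg Prod.snd (Equiv.congr_fun h (x, y))
  have : Subsingleton A := ⟨fun a b => mul_right_cancel ((hsnd a 1).symm.trans (hsnd b 1))⟩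
  obtain ⟨f, hf⟩ := hne
  exact hid (Subsingleton.elim f (fun _ => 1) ▸ hf)
end

section
/- Let A be a finite group with more than one element. For every n with 1 ≤ n ≤ 5, the set of n-round GDES permutations { θ ∘ σ_{f_n} ∘ ⋯ ∘ σ_{f_1} : f₁, …, f_n : A → A all injective } is not a subgroup of the symmetric group on A × A, i.e. it is not the underlying set of any subgroup of Sym(A × A). -/
/-- The `n`-round Feistel permutation `σ_{f n} ∘ ⋯ ∘ σ_{f 1}` (round `f 0` applied
first, round `f (n-1)` applied last). -/
def feistelRounds {A : Type*} [Group A] : (n : ℕ) → (Fin n → A → A) → Equiv.Perm (A × A)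
  | 0, _ => 1
  | n + 1, f => feistel (f (Fin.last n)) * feistelRounds n (fun i => f i.castSucc)

theorem feistel_mul_inv_mul_feistel {A : Type*} [Group A] (f g h : A → A) :
    feistel f * (feistel g)⁻¹ * feistel h = feistel (fun y => h y * (g y)⁻¹ * f y) := by
  ext p <;> simp [feistel, Equiv.Perm.inv_def, mul_assoc]

theorem swapPerm_mul_feistelRounds_four_apply {A : Type*} [Group A] (f : Fin 4 → A → A)
    (x y : A) : (swapPerm A * feistelRounds 4 f) (x, y) =
      (y * f 1 (x * f 0 y) * f 3 (x * f 0 y * f 2 (y * f 1 (x * f 0 y))),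
        x * f 0 y * f 2 (y * f 1 (x * f 0 y))) := rfl

/-- Only for `n = 0` and `n = 4`, among the `n ≤ 5`, can `n` injective rounds followed by the swap
compose to the identity. -/
theorem swapPerm_mul_feistelRounds_ne_one {A : Type*} [Group A] [Nontrivial A] {n : ℕ}
    (h1 : 1 ≤ n) (h5 : n ≤ 5) (h4 : n ≠ 4) {f : Fin n → A → A}
    (hf : ∀ i, Function.Injective (f i)) : swapPerm A * feistelRounds n f ≠ 1 := by
  intro e
  have e' (x y : A) : (swapPerm A * feistelRounds n f) (x, y) = (x, y) := by rw [e]; rfl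
  obtain ⟨t, ht⟩ := exists_ne (1 : A)
  apply ht
  interval_cases n
  · have h (y : A) : f 0 y = 1 := by
      simpa using (show 1 * f 0 y = 1 from congrArg Prod.fst (e' 1 y))
    exact hf 0 ((h t).trans (h 1).symm)
  · have h (x : A) : x * f 0 1 = 1 := congrArg Prod.snd (e' x 1)
    exact mul_right_cancel ((h t).trans (h 1).symm)
  · have h (x : A) : 1 * f 1 (x * f 0 1) = 1 := congrArg Prod.snd (e' x 1)
    exact mul_right_cancel (hf 1 (mul_left_cancel ((h t).trans (h 1).symm)))
  · exact absurd rfl h4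
  · have h (u : A) : f 2 (1 * f 1 u) = (f 0 1)⁻¹ * (f 4 1)⁻¹ := by
      obtain ⟨x, rfl⟩ : ∃ x, x * f 0 1 = u := ⟨u * (f 0 1)⁻¹, by simp⟩
      have h3 : 1 * f 1 (x * f 0 1) * f 3 (x * f 0 1 * f 2 (1 * f 1 (x * f 0 1))) = 1 :=
        congrArg Prod.snd (e' x 1)
      have h4 : x * f 0 1 * f 2 (1 * f 1 (x * f 0 1)) *
          f 4 (1 * f 1 (x * f 0 1) * f 3 (x * f 0 1 * f 2 (1 * f 1 (x * f 0 1)))) = x :=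
        congrArg Prod.fst (e' x 1)
      rw [h3, mul_assoc, mul_assoc, mul_eq_left, ← mul_assoc] at h4
      rw [eq_inv_mul_iff_mul_eq, eq_inv_iff_mul_eq_one, h4]
    exact hf 1 (mul_left_cancel (hf 2 ((h t).trans (h 1).symm)))

/-- If four rounds followed by the swap compose to the identity, then the group is elementary
abelian of exponent two, and the first and last round functions multiply to a translation. -/
theorem elementary_of_four_rounds_eq_one {A : Type*} [Group A] {f : Fin 4 → A → A}
    (h : swapPerm A * feistelRounds 4 f = 1) :
    (∀ x y : A, x * y = y * x) ∧ (∀ x : A, x * x = 1) ∧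
      ∃ k, ∀ y, f 3 y * f 0 y = (y * k)⁻¹ := by
  have key (u y : A) : u * f 2 (y * f 1 u) = y ∧ y * f 1 u * f 3 y = u * (f 0 y)⁻¹ := by
    have e := swapPerm_mul_feistelRounds_four_apply f (u * (f 0 y)⁻¹) y
    rw [h, inv_mul_cancel_right, Equiv.Perm.one_apply, Prod.mk.injEq] at e
    exact ⟨e.2.symm, by rw [e.1, ← e.2]⟩
  have hf (u y : A) : f 1 u = y⁻¹ * u * (f 3 y * f 0 y)⁻¹ := by
    rw [mul_inv_rev, ← mul_assoc, mul_assoc y⁻¹, ← (key u y).2]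
    group
  obtain ⟨k, hk⟩ : ∃ k, ∀ u, f 1 u = u * k :=
    ⟨(f 3 1 * f 0 1)⁻¹, fun u => by simpa using hf u 1⟩
  have hy (y : A) : (f 3 y * f 0 y)⁻¹ = y * k := by
    have := hf 1 y
    rw [hk, one_mul, mul_one, eq_inv_mul_iff_mul_eq] at this
    exact this.symm
  have comm (u y : A) : u * y = y * u := by
    have := hf u y
    rw [hk, hy, ← mul_assoc, mul_left_inj, mul_assoc, eq_inv_mul_iff_mul_eq] at this
    exact this.symm
  refine ⟨comm, fun y => ?_, k, fun y => by rw [← hy, inv_inv]⟩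
  have e1 := (key 1 y).1
  have e2 := (key y 1).1
  rw [hk, one_mul, one_mul] at e1
  rw [hk, one_mul] at e2
  rwa [e1] at e2

/-- In a group of exponent two, the shear `(x, y) ↦ (x, y * h x)`, where `h` is `t` on `{1, t}` and
trivial elsewhere, is not the composition of four injective rounds followed by the swap. -/
theorem shear_ne_four_rounds {A : Type*} [CommGroup A] (hsq : ∀ x : A, x * x = 1)
    {t : A} (ht : t ≠ 1) {h : A → A} (h1 : h 1 = t) (ht' : ∀ x, h x = t → x = 1 ∨ x = t)
    (hval : ∀ x, h x = 1 ∨ h x = t) {f : Fin 4 → A → A} (hf : ∀ i, Function.Injective (f i)) :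
    ¬ ∀ x y, (swapPerm A * feistelRounds 4 f) (x, y) = (x, y * h x) := by
  intro hg
  have cancel (x y : A) : x * (x * y) = y := by rw [← mul_assoc, hsq, one_mul]
  have eq_of_mul {x y : A} (hxy : x * y = 1) : x = y := by rw [← cancel x y, hxy, mul_one]
  have key (u y : A) : y * f 2 (u * f 1 y) = u * h (y * f 0 u) ∧
      u * f 1 y * f 3 (y * f 2 (u * f 1 y)) = y * f 0 u := by
    have e := hg (y * f 0 u) u
    rw [swapPerm_mul_feistelRounds_four_apply, mul_assoc y, hsq, mul_one, Prod.mk.injEq] at e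
    exact e.symm
  have hA (u y : A) : h (y * f 0 u) = u * f 1 y * f 2 (u * f 1 y) * (y * f 1 y) := by
    rw [← cancel u (h _), ← (key u y).1]
    generalize f 2 (u * f 1 y) = z
    simp only [mul_comm, mul_left_comm, hsq, mul_one]
  have period (v : A) : v * t * f 2 (v * t) = v * f 2 v := by
    have hv (w : A) : w * f 2 w = h (f 0 (w * f 1 1)) * f 1 1 := by
      have := hA (w * f 1 1) 1
      rw [one_mul, one_mul, mul_assoc w, hsq, mul_one] at this
      rw [this, mul_assoc, hsq, mul_one]
    have hprod : v * t * f 2 (v * t) * (v * f 2 v) = 1 ∨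
        v * t * f 2 (v * t) * (v * f 2 v) = t := by
      rw [hv, hv, mul_mul_mul_comm, hsq, mul_one]
      rcases hval (f 0 (v * t * f 1 1)) with e | e <;> rcases hval (f 0 (v * f 1 1)) with e' | e' <;>
        simp [e, e', hsq]
    refine eq_of_mul (hprod.resolve_right fun e => ht ?_)
    have e' : t * (f 2 (v * t) * f 2 v) = t := by
      refine Eq.trans ?_ e
      generalize f 2 (v * t) = z
      simp only [mul_assoc, mul_left_comm, cancel]
    exact mul_eq_left.mp (hf 2 (eq_of_mul (mul_eq_left.mp e')))
  have h0 : h (f 0 1 * f 0 t) = t := by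
    have h0 : h (f 0 1 * f 0 t) = h (f 0 1 * f 0 1) := by
      rw [hA, hA, mul_comm t, period, one_mul]
    rw [h0, hsq, h1]
  have h0t : f 0 t = f 0 1 * t := by
    rcases ht' _ h0 with e | e
    · exact absurd (hf 0 (eq_of_mul e)).symm ht
    · rw [← cancel (f 0 1) (f 0 t), e]
  have k1 := (key 1 1).2
  have kt := (key t 1).2
  simp only [one_mul] at k1 kt
  rw [h0t, ← k1, mul_comm _ t, ← mul_assoc, mul_right_inj] at kt
  exact ht (mul_eq_right.mp (hf 2 (hf 3 kt)))

/-- Let `A` be a finite group with more than one element. For every `n`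
with `1 ≤ n ≤ 5`, the set of `n`-round GDES permutations
`{θ ∘ σ_{f n} ∘ ⋯ ∘ σ_{f 1} : f 1, …, f n : A → A all injective}` is not (the
underlying set of) a subgroup of `Sym(A × A)`. -/
theorem gdes_rounds_injective_not_subgroup {A : Type*} [Group A] [Finite A]
    [Nontrivial A] (n : ℕ) (h1 : 1 ≤ n) (h5 : n ≤ 5) :
    ¬ ∃ H : Subgroup (Equiv.Perm (A × A)),
        (H : Set (Equiv.Perm (A × A))) =
          {g | ∃ f : Fin n → A → A, (∀ i, Function.Injective (f i)) ∧
            g = swapPerm A * feistelRounds n f} := by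
  classical
  rintro ⟨H, hH⟩
  have mem (g : Equiv.Perm (A × A)) : g ∈ H ↔ ∃ f : Fin n → A → A,
      (∀ i, Function.Injective (f i)) ∧ g = swapPerm A * feistelRounds n f := by
    rw [← SetLike.mem_coe, hH, Set.mem_ofPred_eq]
  obtain ⟨f, hf, e⟩ := (mem 1).mp H.one_mem
  obtain rfl : n = 4 := by
    by_contra h4
    exact swapPerm_mul_feistelRounds_ne_one h1 h5 h4 hf e.symm
  obtain ⟨comm, hsq, k, hk⟩ := elementary_of_four_rounds_eq_one e.symm
  obtain ⟨t, ht⟩ := exists_ne (1 : A)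
  let _ : CommGroup A := { ‹Group A› with mul_comm := comm }
  have hinv (x : A) : x⁻¹ = x := inv_eq_of_mul_eq_one_left (hsq x)
  let C : Equiv.Perm (A × A) := feistel (Equiv.swap 1 t) * feistel id * feistel id
  have hC (a : A → A) (ha : Function.Injective a) : swapPerm A * (feistel a * C) ∈ H := by
    refine (mem _).mpr ⟨![id, id, Equiv.swap 1 t, a], fun i => ?_, rfl⟩
    fin_cases i
    exacts [Function.injective_id, Function.injective_id, (Equiv.swap 1 t).injective, ha]
  have hmem := H.mul_mem (H.mul_mem (hC _ (hf 0)) (H.inv_mem (hC _ (hf 3))))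
    (hC (· * k) (mul_left_injective k))
  have hcollapse : swapPerm A * (feistel (f 0) * C) * (swapPerm A * (feistel (f 3) * C))⁻¹ *
      (swapPerm A * (feistel (· * k) * C)) = swapPerm A * (feistel (fun _ => 1) * C) := by
    have : feistel (fun _ : A => 1) = feistel (f 0) * (feistel (f 3))⁻¹ * feistel (· * k) := by
      rw [feistel_mul_inv_mul_feistel]
      congr 1
      ext y
      rw [hinv, mul_assoc, hk, mul_inv_cancel]
    rw [this]
    group
  rw [hcollapse] at hmem
  obtain ⟨f', hf', e'⟩ := (mem _).mp hmem
  refine shear_ne_four_rounds hsq ht (h := fun x => x * Equiv.swap 1 t x) (by simp)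
    (fun x hx => ?_) (fun x => ?_) hf' fun x y => ?_
  · by_contra! hne
    rw [Equiv.swap_apply_of_ne_of_ne hne.1 hne.2, hsq] at hx
    exact ht hx.symm
  · by_cases hx1 : x = 1
    · simp [hx1]
    by_cases hxt : x = t
    · simp [hxt]
    · simp [Equiv.swap_apply_of_ne_of_ne hx1 hxt, hsq]
  · rw [← e']
    have hyx : y * (x * y) = x := by rw [comm x, ← mul_assoc, hsq, one_mul]
    change (y * (x * y) * 1, x * y * Equiv.swap 1 t (y * (x * y))) = (x, y * _)
    rw [hyx, mul_one, comm x y, mul_assoc]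
end

section
/- Let A be a finite group of characteristic 2, i.e. every x ∈ A satisfies x ⊕ x = e. Let n ≥ 3 and let f₁, …, f_n : A → A be functions with f₁ = f_n. If the n-round GDES permutation θ ∘ σ_{f_n} ∘ σ_{f_{n-1}} ∘ ⋯ ∘ σ_{f_1} is the identity permutation of A × A, then the (n−2)-round GDES permutation θ ∘ σ_{f_{n-1}} ∘ ⋯ ∘ σ_{f_2} (using the middle round functions f₂, …, f_{n-1}) is also the identity permutation of A × A. Consequently, if no (n−2)-round GDES permutation is the identity, then the set of n-round GDES permutations with f₁ = f_n does not contain the identity and is not a subgroup of Sym(A × A). -/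
/-- The first round of a Feistel permutation can be split off on the right. -/
theorem feistelRounds_succ_eq_mul_feistel {A : Type*} [Group A] (n : ℕ)
    (f : Fin (n + 1) → A → A) :
    feistelRounds (n + 1) f = feistelRounds n (fun i => f i.succ) * feistel (f 0) := by
  induction n with
  | zero => simp [feistelRounds]
  | succ n ih =>
    rw [feistelRounds, ih, feistelRounds, mul_assoc]
    rfl

theorem swapPerm_mul_self (A : Type*) : swapPerm A * swapPerm A = 1 := by
  ext p <;> simp [swapPerm]

/-- In characteristic 2, `θ ∘ σ_f` is an involution. -/
theorem swapPerm_mul_feistel_mul_self {A : Type*} [Group A] (hchar : ∀ x : A, x * x = 1)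
    (f : A → A) : swapPerm A * feistel f * (swapPerm A * feistel f) = 1 := by
  ext p <;> simp [swapPerm, feistel, mul_assoc, hchar]

/-- In characteristic 2, two equal outer rounds can be removed from a product equal to
the identity. -/
theorem swapPerm_mul_eq_one_of_feistel_mul_mul_feistel {A : Type*} [Group A]
    (hchar : ∀ x : A, x * x = 1) (f : A → A) (M : Equiv.Perm (A × A))
    (h : swapPerm A * (feistel f * (M * feistel f)) = 1) : swapPerm A * M = 1 := by
  have hM : M * feistel f = swapPerm A * feistel f := by
    apply mul_left_cancel (a := swapPerm A * feistel f)
    rw [swapPerm_mul_feistel_mul_self hchar, mul_assoc, h]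
  rw [mul_right_cancel hM, swapPerm_mul_self]

/-- Let `A` be a finite group of characteristic 2, let `n ≥ 3` and let
`f₁, …, f_n : A → A` be round functions with `f₁ = f_n`. If the `n`-round GDES
permutation `θ ∘ σ_{f_n} ∘ ⋯ ∘ σ_{f_1}` is the identity, then the `(n-2)`-round GDES
permutation `θ ∘ σ_{f_{n-1}} ∘ ⋯ ∘ σ_{f_2}` built from the middle round functions is
also the identity. Consequently, if no `(n-2)`-round GDES permutation is the identity,
then the set of `n`-round GDES permutations with `f₁ = f_n` does not contain the
identity and is not (the underlying set of) a subgroup of `Sym(A × A)`. -/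
theorem gdes_char_two_reduction {A : Type*} [Group A] [Finite A]
    (hchar : ∀ x : A, x * x = 1) (n : ℕ) (hn : 3 ≤ n) :
    (∀ f : Fin n → A → A, f ⟨0, by omega⟩ = f ⟨n - 1, by omega⟩ →
        swapPerm A * feistelRounds n f = 1 →
        swapPerm A * feistelRounds (n - 2)
            (fun i => f ⟨i.1 + 1, by have := i.isLt; omega⟩) = 1) ∧
    ((∀ g : Fin (n - 2) → A → A, swapPerm A * feistelRounds (n - 2) g ≠ 1) →
      ((1 : Equiv.Perm (A × A)) ∉
          {g | ∃ f : Fin n → A → A, f ⟨0, by omega⟩ = f ⟨n - 1, by omega⟩ ∧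
            g = swapPerm A * feistelRounds n f} ∧
        ¬ ∃ H : Subgroup (Equiv.Perm (A × A)),
          (H : Set (Equiv.Perm (A × A))) =
            {g | ∃ f : Fin n → A → A, f ⟨0, by omega⟩ = f ⟨n - 1, by omega⟩ ∧
              g = swapPerm A * feistelRounds n f})) := by
  have reduction : ∀ f : Fin n → A → A, f ⟨0, by omega⟩ = f ⟨n - 1, by omega⟩ →
      swapPerm A * feistelRounds n f = 1 →
      swapPerm A * feistelRounds (n - 2)
          (fun i => f ⟨i.1 + 1, by have := i.isLt; omega⟩) = 1 := by
    obtain ⟨m, rfl⟩ : ∃ m, n = m + 2 := ⟨n - 2, by omega⟩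
    intro f hf h
    rw [feistelRounds, feistelRounds_succ_eq_mul_feistel] at h
    have hlast : f (Fin.last (m + 1)) = f (Fin.castSucc 0) := hf.symm
    rw [hlast] at h
    exact swapPerm_mul_eq_one_of_feistel_mul_mul_feistel hchar _ _ h
  refine ⟨reduction, fun hne => ?_⟩
  rw [← not_or]
  rintro (⟨f, hf, h⟩ | ⟨H, hH⟩)
  · exact hne _ (reduction f hf h.symm)
  · obtain ⟨f, hf, h⟩ := hH.subset H.one_mem
    exact hne _ (reduction f hf h.symm)
end
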